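/- arXiv:0906.2795 — 3 statements merged into one kernel-verified Lean document; each statement's English description precedes it below -/
import Mathlib

section
/- For every n and every subset I ⊆ {1,...,n−1}, the number of elements τ ∈ T⁰_n with descent set D(τ) = I equals the number of permutations σ ∈ S_n with D(σ) = I. -/
def descSeq {n : ℕ} (f : Fin n → ℕ) : Finset ℕ :=
  (Finset.range (n - 1)).filter
    (fun i => ∃ h : i + 1 < n, f ⟨i + 1, h⟩ < f ⟨i, Nat.lt_of_succ_lt h⟩)

def descSet {n : ℕ} (σ : Equiv.Perm (Fin n)) : Finset ℕ :=
  descSeq (fun i => (σ i : ℕ))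

def IsCyclic' {n : ℕ} (π : Equiv.Perm (Fin n)) : Prop :=
  ∀ x y : Fin n, ∃ k : ℕ, (π ^ k) x = y

def compParts (n : ℕ) (I : Finset ℕ) : Multiset ℕ :=
  ↑(List.zipWith (· - ·) ((I.sort (· ≤ ·)).map (· + 1) ++ [n])
      (0 :: (I.sort (· ≤ ·)).map (· + 1)))

def fullCycleType {n : ℕ} (π : Equiv.Perm (Fin n)) : Multiset ℕ :=
  π.cycleType + Multiset.replicate (n - π.support.card) 1

def InT0 (n : ℕ) (τ : Fin n → ℕ) : Prop :=
  ∃ (π : Equiv.Perm (Fin n)) (k : Fin n), IsCyclic' π ∧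
    τ = Function.update (fun i => ((π i : ℕ) + 1)) k 0

def InU (n : ℕ) (τ : Fin n → ℕ) : Prop :=
  ∃ (π : Equiv.Perm (Fin n)) (k : Fin n), IsCyclic' π ∧
    τ = Function.update (fun i => ((π i : ℕ) + 1)) k (n + 1)

def extPerm {n : ℕ} (π : Equiv.Perm (Fin n)) : Equiv.Perm (Fin (n + 1)) :=
  (finSuccEquivLast (n := n)).symm.permCongr π.optionCongr

def extCycle {n : ℕ} (π : Equiv.Perm (Fin n)) (k : Fin n) : Equiv.Perm (Fin (n + 1)) :=
  extPerm π * Equiv.swap (Fin.castSucc k) (Fin.last n)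

/-- The index of the block containing `i` when the positions are cut after every element of `I`. -/
def blockIndex (I : Finset ℕ) (i : ℕ) : ℕ := (I.filter (· < i)).card

theorem blockIndex_mono (I : Finset ℕ) : Monotone (blockIndex I) := fun _ _ h =>
  Finset.card_le_card (Finset.monotone_filter_right _ fun _ _ hx => lt_of_lt_of_le hx h)

theorem blockIndex_lt {I : Finset ℕ} {i j m : ℕ} (hm : m ∈ I) (him : i ≤ m) (hmj : m < j) :
    blockIndex I i < blockIndex I j := by
  refine Finset.card_lt_card (Finset.ssubset_iff_of_subset ?_ |>.2 ⟨m, ?_, ?_⟩)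
  · exact Finset.monotone_filter_right _ fun x _ (hx : x < i) => by omega
  · simp [hm, hmj]
  · simp [him]

theorem blockIndex_succ {I : Finset ℕ} {i : ℕ} (hi : i ∉ I) :
    blockIndex I i = blockIndex I (i + 1) := by
  unfold blockIndex
  congr 1
  refine Finset.filter_congr fun x hx => ?_
  have : x ≠ i := fun h => hi (h ▸ hx)
  omega

theorem descSeq_subset_iff {n : ℕ} (f : Fin n → ℕ) (I : Finset ℕ) :
    descSeq f ⊆ I ↔
      ∀ i j : Fin n, i ≤ j → blockIndex I i = blockIndex I j → f i ≤ f j := by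
  constructor
  · rintro h ⟨i, hi⟩ ⟨j, hj⟩ hle hb
    replace hle : i ≤ j := hle
    simp only at hb
    revert hj
    induction j, hle using Nat.le_induction with
    | base => exact fun _ => le_rfl
    | succ j hij ih =>
      intro hj
      have hb1 := blockIndex_mono I hij
      have hb2 := blockIndex_mono I (Nat.le_add_right j 1)
      refine (ih (by omega) (Nat.lt_of_succ_lt hj)).trans ?_
      by_contra hlt
      have hmem : j ∈ I := h <| by
        simp only [descSeq, Finset.mem_filter, Finset.mem_range]
        exact ⟨by omega, hj, not_le.1 hlt⟩
      have := blockIndex_lt hmem hij (Nat.lt_add_one j)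
      omega
  · intro h i hi
    simp only [descSeq, Finset.mem_filter, Finset.mem_range] at hi
    obtain ⟨-, hn, hlt⟩ := hi
    by_contra hI
    exact absurd (h ⟨i, _⟩ ⟨i + 1, hn⟩ (Nat.le_succ i) (blockIndex_succ hI)) (not_le.2 hlt)

/-- The successor map of the path that visits `s.symm 0, s.symm 1, …` in this order, with values
shifted by one and the value `0` at the end of the path. -/
def pathSucc {n : ℕ} (s : Equiv.Perm (Fin n)) (i : Fin n) : ℕ :=
  if h : (s i : ℕ) + 1 < n then (s.symm ⟨s i + 1, h⟩ : ℕ) + 1 else 0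

theorem pathSucc_symm {n : ℕ} (s : Equiv.Perm (Fin n)) (p : ℕ) (hp : p + 1 < n) :
    pathSucc s (s.symm ⟨p, Nat.lt_of_succ_lt hp⟩) = (s.symm ⟨p + 1, hp⟩ : ℕ) + 1 := by
  simp [pathSucc, hp]

theorem pathSucc_injective {n : ℕ} (s : Equiv.Perm (Fin n)) :
    Function.Injective (pathSucc s) := by
  intro x y h
  have hx := (s x).isLt
  have hy := (s y).isLt
  apply s.injective
  unfold pathSucc at h
  split_ifs at h with h1 h2 h2
  · have := s.symm.injective (Fin.ext (Nat.succ_injective h))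
    simp only [Fin.mk.injEq, Nat.add_right_cancel_iff] at this
    exact Fin.ext this
  · ext; omega

theorem pathSucc_inj {n : ℕ} :
    Function.Injective (pathSucc : Equiv.Perm (Fin n) → Fin n → ℕ) := by
  intro s t h
  have key : ∀ d p : ℕ, ∀ hp : p < n, p + d + 1 = n → s.symm ⟨p, hp⟩ = t.symm ⟨p, hp⟩ := by
    intro d
    induction d with
    | zero =>
      intro p hp hd
      apply pathSucc_injective s
      conv_rhs => rw [h]
      simp [pathSucc, show ¬ p + 1 < n by omega]
    | succ d ih =>
      intro p hp hd
      apply pathSucc_injective s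
      conv_rhs => rw [h]
      rw [pathSucc_symm s p (by omega), pathSucc_symm t p (by omega),
        ih (p + 1) (by omega) (by omega)]
  have : s.symm = t.symm := by
    ext ⟨p, hp⟩
    rw [key (n - 1 - p) p hp (by omega)]
  exact Equiv.symm_bijective.injective this

open Fin.NatCast Fin.CommRing in
theorem finRotate_pow_apply (m k : ℕ) (i : Fin (m + 1)) :
    (finRotate (m + 1) ^ k) i = i + (k : Fin (m + 1)) := by
  induction k with
  | zero => simp
  | succ k ih => rw [pow_succ', Equiv.Perm.mul_apply, ih, finRotate_apply]; push_cast; ring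

open Fin.NatCast Fin.CommRing in
theorem inT0_pathSucc {n : ℕ} (hn : 1 ≤ n) (s : Equiv.Perm (Fin n)) : InT0 n (pathSucc s) := by
  obtain ⟨m, rfl⟩ : ∃ m, n = m + 1 := ⟨n - 1, by omega⟩
  refine ⟨s⁻¹ * finRotate (m + 1) * s, s.symm (Fin.last m), fun x y => ?_, ?_⟩
  · refine ⟨(s y - s x).val, ?_⟩
    have : ∀ k : ℕ, (s⁻¹ * finRotate (m + 1) * s) ^ k = s⁻¹ * finRotate (m + 1) ^ k * s := by
      intro k
      have := conj_pow (a := s⁻¹) (b := finRotate (m + 1)) (i := k)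
      rwa [inv_inv] at this
    rw [this, Equiv.Perm.mul_apply, Equiv.Perm.mul_apply, finRotate_pow_apply]
    simp
  · funext i
    obtain ⟨p, rfl⟩ := s.symm.surjective i
    by_cases hp : p = Fin.last m
    · subst hp
      simp [pathSucc]
    · have hlt : (p : ℕ) < m := Fin.val_lt_last hp
      rw [Function.update_of_ne (by simpa using hp)]
      have hrot : finRotate (m + 1) p = ⟨p + 1, by omega⟩ := finRotate_of_lt hlt
      simp [pathSucc, hlt, hrot, Equiv.Perm.inv_def]

theorem exists_pathSucc_of_inT0 {n : ℕ} {τ : Fin n → ℕ} (h : InT0 n τ) :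
    ∃ s : Equiv.Perm (Fin n), pathSucc s = τ := by
  obtain ⟨π, k, hπ, rfl⟩ := h
  let g : Fin n → Fin n := fun p => (π ^ (p + 1 : ℕ)) k
  have hsurj : Function.Surjective g := by
    intro y
    obtain ⟨j, hj⟩ := hπ (π k) y
    have hper : π k ∈ Function.periodicPts π := Function.Injective.mem_periodicPts π.injective _
    have hle : Function.minimalPeriod π (π k) ≤ n := by
      simpa using Function.minimalPeriod_le_card (f := π) (x := π k)
    have hpos := Function.minimalPeriod_pos_of_mem_periodicPts hper
    refine ⟨⟨j % Function.minimalPeriod π (π k), (Nat.mod_lt _ hpos).trans_le hle⟩, ?_⟩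
    rw [← hj]
    simp only [g, pow_succ, Equiv.Perm.mul_apply]
    rw [Equiv.Perm.coe_pow, Equiv.Perm.coe_pow, Function.iterate_mod_minimalPeriod_eq]
  have hinj : Function.Injective g := Finite.injective_iff_surjective.2 hsurj
  have hg : ∀ p : ℕ, ∀ hp : p + 1 < n,
      g ⟨p + 1, hp⟩ = π (g ⟨p, Nat.lt_of_succ_lt hp⟩) := fun p hp => by
    simp only [g]; rw [pow_succ', Equiv.Perm.mul_apply]
  have hlast : ∀ p : Fin n, g p = k ↔ (p : ℕ) + 1 = n := by
    have hfwd : ∀ p : Fin n, g p = k → (p : ℕ) + 1 = n := by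
      rintro ⟨p, hp⟩ hpk
      by_contra hne
      have h1 : p + 1 < n := by simp only at hne; omega
      have h2 : g ⟨p + 1, h1⟩ = g ⟨0, by omega⟩ := by
        rw [hg, hpk]; simp [g]
      simpa using hinj h2
    refine fun p => ⟨hfwd p, fun hp => ?_⟩
    obtain ⟨q, hq⟩ := hsurj k
    have := hfwd q hq
    rwa [show p = q from Fin.ext (by omega)]
  refine ⟨(Equiv.ofBijective g ⟨hinj, hsurj⟩).symm, ?_⟩
  funext i
  obtain ⟨p, rfl⟩ := hsurj i
  have hs : (Equiv.ofBijective g ⟨hinj, hsurj⟩).symm (g p) = p :=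
    Equiv.ofBijective_symm_apply_apply g _ p
  by_cases hp : (p : ℕ) + 1 < n
  · rw [Function.update_of_ne (by rw [Ne, hlast]; omega)]
    simp only [pathSucc, hs, hp, dif_pos, Equiv.symm_symm]
    exact congrArg (fun x : Fin n => (x : ℕ) + 1) (hg p hp)
  · have := (hlast p).2 (by omega)
    rw [this, Function.update_self, ← this]
    simp [pathSucc, hs, hp]

/-- The suffix of the word `w` that starts at position `p`. -/
def wordSuffix {n : ℕ} (w : Fin n → ℕ) (p : ℕ) : List ℕ := (List.ofFn w).drop p

theorem wordSuffix_eq_cons {n : ℕ} (w : Fin n → ℕ) (p : Fin n) :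
    wordSuffix w p = w p :: wordSuffix w (p + 1) := by
  rw [wordSuffix, List.drop_eq_getElem_cons (by simp)]
  simp [wordSuffix]

theorem wordSuffix_of_le {n : ℕ} (w : Fin n → ℕ) {p : ℕ} (hp : n ≤ p) : wordSuffix w p = [] :=
  List.drop_eq_nil_of_le (by simpa using hp)

theorem wordSuffix_injective {n : ℕ} (w : Fin n → ℕ) :
    Function.Injective fun p : Fin n => wordSuffix w p := by
  intro p q h
  have := congrArg List.length h
  simp only [wordSuffix, List.length_drop, List.length_ofFn] at this
  ext; omega

/-- A permutation whose path is increasing on blocks lists the suffixes of its block word in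
lexicographic order. -/
theorem wordSuffix_lt_of_pathSucc {n : ℕ} {b : Fin n → ℕ} (hb : Monotone b)
    {s : Equiv.Perm (Fin n)}
    (hs : ∀ i j, i ≤ j → b i = b j → pathSucc s i ≤ pathSucc s j) :
    ∀ d : ℕ, ∀ p q : Fin n, n ≤ p + d → s.symm p < s.symm q →
      wordSuffix (b ∘ s.symm) p < wordSuffix (b ∘ s.symm) q := by
  intro d
  induction d with
  | zero => intro p q hd; have := p.isLt; omega
  | succ d ih =>
    intro p q hd hlt
    rw [wordSuffix_eq_cons, wordSuffix_eq_cons, List.cons_lt_cons_iff]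
    rcases (hb hlt.le).lt_or_eq with h | h
    · exact Or.inl h
    refine Or.inr ⟨h, ?_⟩
    have hτ : pathSucc s (s.symm p) < pathSucc s (s.symm q) :=
      lt_of_le_of_ne (hs _ _ hlt.le h) fun he => hlt.ne (pathSucc_injective s he)
    have hq : (q : ℕ) + 1 < n := by
      by_contra hq
      simp [pathSucc, hq] at hτ
    by_cases hp : (p : ℕ) + 1 < n
    · refine ih ⟨p + 1, hp⟩ ⟨q + 1, hq⟩ (by simp only; omega) ?_
      have h1 := pathSucc_symm s p hp
      have h2 := pathSucc_symm s q hq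
      simp only [Fin.eta] at h1 h2
      rw [Fin.lt_def]
      omega
    · rw [wordSuffix_of_le _ (by omega), wordSuffix_eq_cons _ ⟨q + 1, hq⟩]
      exact List.nil_lt_cons _ _

theorem comp_symm_eq_of_monotone {n : ℕ} {b : Fin n → ℕ} (hb : Monotone b)
    {s t : Equiv.Perm (Fin n)} (h : Monotone ((b ∘ t.symm) ∘ s)) : b ∘ s.symm = b ∘ t.symm := by
  have h1 : (b ∘ t.symm) ∘ s = (b ∘ t.symm) ∘ t :=
    Tuple.unique_monotone h (by simpa [Function.comp_assoc] using hb)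
  funext p
  have := congrFun h1 (s.symm p)
  simpa using this.symm

theorem bijOn_pathSucc {n : ℕ} {b : Fin n → ℕ} (hb : Monotone b) :
    Set.BijOn (fun s : Equiv.Perm (Fin n) => b ∘ s.symm)
      {s | ∀ i j, i ≤ j → b i = b j → pathSucc s i ≤ pathSucc s j}
      (Set.range fun s : Equiv.Perm (Fin n) => b ∘ s.symm) := by
  refine ⟨fun s _ => ⟨s, rfl⟩, fun s hs t ht hst => ?_, ?_⟩
  · have hsort : ∀ r : Equiv.Perm (Fin n),
        (∀ i j, i ≤ j → b i = b j → pathSucc r i ≤ pathSucc r j) →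
        r = Tuple.sort fun p : Fin n => wordSuffix (b ∘ r.symm) p := by
      intro r hr
      have hlt : StrictMono ((fun p : Fin n => wordSuffix (b ∘ r.symm) p) ∘ r) := by
        intro i j hij
        exact wordSuffix_lt_of_pathSucc hb hr n (r i) (r j) (by omega) (by simpa using hij)
      exact Tuple.eq_sort_iff.2 ⟨hlt.monotone, fun i j hij he => absurd he (hlt hij).ne⟩
    rw [hsort s hs, hsort t ht]
    simp only at hst
    rw [hst]
  · rintro _ ⟨t, rfl⟩
    set w := b ∘ t.symm
    set s := Tuple.sort fun p : Fin n => wordSuffix w p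
    have hmono : Monotone ((fun p : Fin n => wordSuffix w p) ∘ s) := Tuple.monotone_sort _
    have hwmono : Monotone (w ∘ s) := by
      intro i j hij
      have := hmono hij
      simp only [Function.comp_apply] at this ⊢
      rw [wordSuffix_eq_cons, wordSuffix_eq_cons] at this
      by_contra hlt
      exact absurd (List.cons_lt_cons_iff.2 (Or.inl (not_le.1 hlt))) (not_lt.2 this)
    have hsw : b ∘ s.symm = w := comp_symm_eq_of_monotone hb hwmono
    refine ⟨s, fun i j hij hbij => ?_, hsw⟩
    rcases hij.eq_or_lt with rfl | hij
    · exact le_rfl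
    have hstrict : StrictMono ((fun p : Fin n => wordSuffix w p) ∘ s) :=
      hmono.strictMono_of_injective ((wordSuffix_injective w).comp s.injective)
    have hlt := hstrict hij
    simp only [Function.comp_apply] at hlt
    have hbw : ∀ i, w (s i) = b i := fun i => by rw [← hsw]; simp
    rw [wordSuffix_eq_cons, wordSuffix_eq_cons, List.cons_lt_cons_iff, hbw, hbw] at hlt
    replace hlt := (hlt.resolve_left hbij.not_lt).2
    by_cases hi : (s i : ℕ) + 1 < n
    · have hj : (s j : ℕ) + 1 < n := by
        by_contra hj
        rw [wordSuffix_of_le w (p := s j + 1) (by omega)] at hlt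
        exact List.not_lt_nil _ hlt
      have : s.symm ⟨s i + 1, hi⟩ < s.symm ⟨s j + 1, hj⟩ := by
        rw [← hstrict.lt_iff_lt]
        simpa using hlt
      rw [Fin.lt_def] at this
      simp only [pathSucc, hi, hj, dif_pos]
      omega
    · simp [pathSucc, hi]

theorem bijOn_perm {n : ℕ} {b : Fin n → ℕ} (hb : Monotone b) :
    Set.BijOn (fun s : Equiv.Perm (Fin n) => b ∘ s.symm)
      {s | ∀ i j, i ≤ j → b i = b j → (s i : ℕ) ≤ s j}
      (Set.range fun s : Equiv.Perm (Fin n) => b ∘ s.symm) := by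
  refine ⟨fun s _ => ⟨s, rfl⟩, fun s hs t ht hst => ?_, ?_⟩
  · have hsort : ∀ r : Equiv.Perm (Fin n),
        (∀ i j, i ≤ j → b i = b j → (r i : ℕ) ≤ r j) → r = Tuple.sort (b ∘ r.symm) := by
      intro r hr
      refine Tuple.eq_sort_iff.2 ⟨by simpa [Function.comp_assoc] using hb, fun i j hij he => ?_⟩
      exact lt_of_le_of_ne (hr i j hij.le (by simpa using he)) (r.injective.ne hij.ne)
    rw [hsort s hs, hsort t ht]
    simp only at hst
    rw [hst]
  · rintro _ ⟨t, rfl⟩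
    set s := Tuple.sort (b ∘ t.symm) with hs
    have hst : b ∘ s.symm = b ∘ t.symm := comp_symm_eq_of_monotone hb (Tuple.monotone_sort _)
    refine ⟨s, fun i j hij hbij => ?_, hst⟩
    rcases hij.eq_or_lt with rfl | hij
    · exact le_rfl
    refine (((Tuple.eq_sort_iff.1 hs).2 i j hij ?_).le : s i ≤ s j)
    rw [← hst]
    simpa using hbij

theorem card_filter_subset {α : Type*} [Fintype α] (f : α → Finset ℕ) (I : Finset ℕ) :
    (Finset.univ.filter fun a => f a ⊆ I).card =
      (Finset.univ.filter fun a => f a = I).card +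
        ∑ J ∈ I.ssubsets, (Finset.univ.filter fun a => f a = J).card := by
  rw [Finset.card_eq_sum_card_fiberwise (f := f) (t := insert I I.ssubsets)]
  · rw [Finset.sum_insert (by simp)]
    congr 1
    · congr 1; ext a; simp; rintro rfl; rfl
    · refine Finset.sum_congr rfl fun J hJ => ?_
      congr 1; ext a
      simp only [Finset.mem_filter, Finset.mem_univ, true_and, and_iff_right_iff_imp]
      rintro rfl
      exact (Finset.mem_ssubsets.1 hJ).subset
  · intro a ha
    simp only [Finset.coe_filter, Finset.mem_univ, true_and, Set.mem_ofPred_eq] at ha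
    simpa using ha.eq_or_ssubset

/-- Two finset-valued statistics with the same cumulative counts are equidistributed. -/
theorem card_filter_eq_of_card_filter_subset {α : Type*} [Fintype α] (f g : α → Finset ℕ)
    (h : ∀ I, (Finset.univ.filter fun a => f a ⊆ I).card =
      (Finset.univ.filter fun a => g a ⊆ I).card) (I : Finset ℕ) :
    (Finset.univ.filter fun a => f a = I).card = (Finset.univ.filter fun a => g a = I).card := by
  induction I using Finset.strongInduction with
  | H I ih =>
    have hI := h I
    rw [card_filter_subset, card_filter_subset,
      Finset.sum_congr rfl fun J hJ => ih J (Finset.mem_ssubsets.1 hJ)] at hI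
    exact Nat.add_right_cancel hI

theorem card_descSeq_pathSucc_subset (n : ℕ) (I : Finset ℕ) :
    (Finset.univ.filter fun s : Equiv.Perm (Fin n) => descSeq (pathSucc s) ⊆ I).card =
      (Finset.univ.filter fun s : Equiv.Perm (Fin n) => descSet s ⊆ I).card := by
  have hb : Monotone fun i : Fin n => blockIndex I i :=
    fun _ _ hij => blockIndex_mono I hij
  have h := (bijOn_pathSucc hb).ncard_eq.trans (bijOn_perm hb).ncard_eq.symm
  rw [← Set.ncard_coe_finset, ← Set.ncard_coe_finset]
  simpa only [Finset.coe_filter, Finset.mem_univ, true_and, descSet, descSeq_subset_iff] using h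

theorem stmt6 (n : ℕ) (hn : 1 ≤ n) (I : Finset ℕ) :
    Nat.card {τ : Fin n → ℕ // InT0 n τ ∧ descSeq τ = I}
      = Nat.card {σ : Equiv.Perm (Fin n) // descSet σ = I} := by
  let φ : {s : Equiv.Perm (Fin n) // descSeq (pathSucc s) = I} →
      {τ : Fin n → ℕ // InT0 n τ ∧ descSeq τ = I} :=
    fun s => ⟨pathSucc s.1, inT0_pathSucc hn s.1, s.2⟩
  have hφ : Function.Bijective φ := by
    refine ⟨fun s t h => Subtype.ext (pathSucc_inj (congrArg Subtype.val h)), ?_⟩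
    rintro ⟨τ, hτ, hI⟩
    obtain ⟨s, rfl⟩ := exists_pathSucc_of_inT0 hτ
    exact ⟨⟨s, hI⟩, rfl⟩
  rw [← Nat.card_eq_of_bijective φ hφ, Nat.card_eq_fintype_card, Nat.card_eq_fintype_card,
    Fintype.card_subtype, Fintype.card_subtype]
  exact card_filter_eq_of_card_filter_subset _ _ (card_descSeq_pathSucc_subset n) I
end

section
/- Fix 1 ≤ m ≤ n and let J = {1,...,n−1} \ {m−1, m}. For any I ⊆ J, the number of cyclic permutations π of {1,...,n} with D(π) ∩ J = I equals the number of permutations σ of {1,...,n} with σ(m) = 1 and D(σ) ∩ J = I. -/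
/-- `f` is strictly increasing on every fibre of `b`. -/
def StrictMonoOnFibers {n : ℕ} (b : Fin n → ℕ) (f : Equiv.Perm (Fin n)) : Prop :=
  ∀ ⦃x y : Fin n⦄, x < y → b x = b y → f x < f y

theorem eq_of_monotone_comp_perm {n : ℕ} {α : Type*} [PartialOrder α] {key : Fin n → α}
    (hkey : Function.Injective key) {s t : Equiv.Perm (Fin n)}
    (hs : Monotone (key ∘ s)) (ht : Monotone (key ∘ t)) : s = t := by
  ext x
  exact congrArg Fin.val (hkey (congrFun (Tuple.unique_monotone hs ht) x))

theorem comp_sort_eq_of_monotone {n : ℕ} {α : Type*} [LinearOrder α] {key : Fin n → α}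
    {b w : Fin n → ℕ} {e : Equiv.Perm (Fin n)} (hb : Monotone b) (hw : w = b ∘ e)
    (hkw : ∀ i j, key i ≤ key j → w i ≤ w j) : w ∘ Tuple.sort key = b := by
  have h₁ : Monotone (w ∘ Tuple.sort key) := fun x y hxy =>
    hkw _ _ (Tuple.monotone_sort key hxy)
  have h₂ : w ∘ e.symm = b := by
    funext x
    simp [hw]
  have h₃ : Monotone (w ∘ e.symm) := by rwa [h₂]
  exact (Tuple.unique_monotone h₁ h₃).trans h₂

/-- Rearrangements of `b` whose initial letter is `b p`. -/
def rearrangements {N : ℕ} (b : Fin (N + 1) → ℕ) (p : Fin (N + 1)) : Set (Fin (N + 1) → ℕ) :=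
  {w | w 0 = b p ∧ ∃ e : Equiv.Perm (Fin (N + 1)), w = b ∘ e}

theorem eq_zero_of_mem_rearrangements {N : ℕ} {b w : Fin (N + 1) → ℕ} {p : Fin (N + 1)}
    (hp : ∀ x, b x = b p → x = p) (hw : w ∈ rearrangements b p) {i : Fin (N + 1)}
    (hi : w i = w 0) : i = 0 := by
  obtain ⟨h₀, e, rfl⟩ := hw
  have h₁ := hp _ h₀
  have h₂ := hp _ (hi.trans h₀)
  exact e.injective (h₂.trans h₁.symm)

theorem card_strictMonoOnFibers_eq_card_rearrangements {N : ℕ} {b : Fin (N + 1) → ℕ}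
    {p : Fin (N + 1)} (hb : Monotone b) (hp : ∀ x, b x = b p → x = p) :
    Nat.card {σ : Equiv.Perm (Fin (N + 1)) // σ p = 0 ∧ StrictMonoOnFibers b σ} =
      Nat.card (rearrangements b p) := by
  refine Nat.card_congr (Equiv.ofBijective
    (fun σ => ⟨b ∘ σ.1.symm, by simp [σ.1.symm_apply_eq.2 σ.2.1.symm], σ.1.symm, rfl⟩) ⟨?_, ?_⟩)
  · rintro ⟨σ, _, hσ⟩ ⟨τ, _, hτ⟩ h
    have h' : b ∘ σ.symm = b ∘ τ.symm := congrArg Subtype.val h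
    have aux : ∀ ρ : Equiv.Perm (Fin (N + 1)), StrictMonoOnFibers b ρ →
        Monotone ((fun i => toLex (b (ρ.symm i), i)) ∘ ρ) := by
      intro ρ hρ x y hxy
      rcases hxy.eq_or_lt with rfl | hlt
      · exact le_rfl
      · simp only [Function.comp_apply, Equiv.symm_apply_apply, Prod.Lex.toLex_le_toLex]
        rcases (hb hxy).lt_or_eq with h | h
        · exact Or.inl h
        · exact Or.inr ⟨h, (hρ hlt h).le⟩
    have hk : (fun i => toLex (b (σ.symm i), i)) = fun i => toLex (b (τ.symm i), i) := by
      funext i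
      have := congrFun h' i
      simp only [Function.comp_apply] at this
      rw [this]
    refine Subtype.ext (eq_of_monotone_comp_perm ?_ (aux σ hσ) (hk ▸ aux τ hτ))
    intro i j hij
    exact congrArg (fun z => (ofLex z).2) hij
  · rintro ⟨w, hw⟩
    obtain ⟨h₀, e, he⟩ := id hw
    let key : Fin (N + 1) → ℕ ×ₗ Fin (N + 1) := fun i => toLex (w i, i)
    have hs : w ∘ Tuple.sort key = b := by
      refine comp_sort_eq_of_monotone hb he fun i j hij => ?_
      rcases Prod.Lex.toLex_le_toLex.1 hij with h | h
      · exact h.le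
      · exact h.1.le
    have hs' : ∀ x, w (Tuple.sort key x) = b x := congrFun hs
    refine ⟨⟨Tuple.sort key, ?_, ?_⟩, Subtype.ext ?_⟩
    · exact eq_zero_of_mem_rearrangements hp hw ((hs' p).trans h₀.symm)
    · intro x y hxy hbxy
      have h := Prod.Lex.toLex_le_toLex.1 (Tuple.monotone_sort key hxy.le)
      simp only [hs', hbxy, lt_irrefl, true_and, false_or] at h
      exact lt_of_le_of_ne h fun h' => hxy.ne ((Tuple.sort key).injective h')
    · funext i
      simp [← hs]

theorem finRotate_pow_val {N : ℕ} (k : ℕ) (i : Fin (N + 1)) :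
    (((finRotate (N + 1)) ^ k) i : ℕ) = (i + k) % (N + 1) := by
  induction k with
  | zero => simp [Nat.mod_eq_of_lt i.isLt]
  | succ k ih =>
    rw [pow_succ', Equiv.Perm.mul_apply, finRotate_apply, Fin.val_add, ih, Fin.val_one',
      ← Nat.add_mod, add_assoc]

theorem isCyclic'_finRotate (N : ℕ) : IsCyclic' (finRotate (N + 1)) := by
  intro x y
  refine ⟨N + 1 - x + y, Fin.ext ?_⟩
  rw [finRotate_pow_val, show (x : ℕ) + (N + 1 - x + y) = y + (N + 1) by omega,
    Nat.add_mod_right, Nat.mod_eq_of_lt y.isLt]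

theorem IsCyclic'.isCycleOn {n : ℕ} {π : Equiv.Perm (Fin n)} (h : IsCyclic' π) :
    π.IsCycleOn ((Finset.univ : Finset (Fin n)) : Set (Fin n)) := by
  refine ⟨by simp [Set.bijOn_univ], fun x _ y _ => ?_⟩
  obtain ⟨k, hk⟩ := h x y
  exact ⟨k, by simpa using hk⟩

/-- A full cycle is conjugate to the rotation, with a prescribed image of `0`. -/
theorem IsCyclic'.exists_semiconj_finRotate {N : ℕ} {π : Equiv.Perm (Fin (N + 1))}
    (h : IsCyclic' π) (p : Fin (N + 1)) :
    ∃ e : Equiv.Perm (Fin (N + 1)), (∀ i : Fin (N + 1), e i = (π ^ (i : ℕ)) p) ∧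
      ∀ (k : ℕ) (i : Fin (N + 1)), e ((finRotate (N + 1) ^ k) i) = (π ^ k) (e i) := by
  have hsurj : Function.Surjective fun i : Fin (N + 1) => (π ^ (i : ℕ)) p := by
    intro y
    obtain ⟨k, hk, hy⟩ := h.isCycleOn.exists_pow_eq (Finset.mem_univ p) (Finset.mem_univ y)
    exact ⟨⟨k, by simpa using hk⟩, hy⟩
  refine ⟨Equiv.ofBijective _ (Finite.injective_iff_bijective.1
    (Finite.injective_iff_surjective.2 hsurj)), fun i => rfl, fun k i => ?_⟩
  simp only [Equiv.ofBijective_apply, finRotate_pow_val]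
  rw [← Equiv.Perm.mul_apply, ← pow_add,
    h.isCycleOn.pow_apply_eq_pow_apply (Finset.mem_univ p), add_comm k]
  simpa using Nat.mod_modEq _ _

/-- The sequence of letters read off from `b` along the `π`-orbit of `x`, ordered
lexicographically. -/
def itinerary {n : ℕ} (π : Equiv.Perm (Fin n)) (b : Fin n → ℕ) (x : Fin n) : Lex (ℕ → ℕ) :=
  toLex fun k => b ((π ^ k) x)

theorem itinerary_monotone {n : ℕ} {π : Equiv.Perm (Fin n)} {b : Fin n → ℕ} (hb : Monotone b)
    (hπ : StrictMonoOnFibers b π) : Monotone (itinerary π b) := by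
  intro x y hxy
  rcases hxy.eq_or_lt with rfl | hlt
  · exact le_rfl
  by_contra hcon
  obtain ⟨k, hk, hk'⟩ := not_le.1 hcon
  have key : ∀ j ≤ k, (π ^ j) x < (π ^ j) y := by
    intro j
    induction j with
    | zero => simpa using hlt
    | succ j ih =>
      intro hj
      rw [pow_succ', Equiv.Perm.mul_apply, Equiv.Perm.mul_apply]
      exact hπ (ih (by omega)) (hk j (by omega)).symm
  exact absurd (hb (key k le_rfl).le) (not_le.2 hk')

theorem apply_le_of_itinerary_le {n : ℕ} {π : Equiv.Perm (Fin n)} {b : Fin n → ℕ} {x y : Fin n}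
    (h : itinerary π b x ≤ itinerary π b y) : b x ≤ b y :=
  Pi.apply_le_of_toLex (i := 0) h (by simp)

theorem itinerary_apply_lt {n : ℕ} {π : Equiv.Perm (Fin n)} {b : Fin n → ℕ} {x y : Fin n}
    (h : itinerary π b x < itinerary π b y) (hb : b x = b y) :
    itinerary π b (π x) < itinerary π b (π y) := by
  obtain ⟨k, hk, hk'⟩ := h
  cases k with
  | zero => exact absurd hk' (by simp [itinerary, hb])
  | succ k => exact ⟨k, fun j hj => hk (j + 1) (by omega), hk'⟩

theorem itinerary_finRotate_injective {N : ℕ} {b w : Fin (N + 1) → ℕ} {p : Fin (N + 1)}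
    (hp : ∀ x, b x = b p → x = p) (hw : w ∈ rearrangements b p) :
    Function.Injective (itinerary (finRotate (N + 1)) w) := by
  intro i j hij
  obtain ⟨k, hk⟩ := isCyclic'_finRotate N i 0
  have h : w ((finRotate (N + 1) ^ k) i) = w ((finRotate (N + 1) ^ k) j) := congrFun hij k
  rw [hk] at h
  exact (finRotate (N + 1) ^ k).injective
    (hk.trans (eq_zero_of_mem_rearrangements hp hw h.symm).symm)

theorem card_isCyclic'_eq_card_rearrangements {N : ℕ} {b : Fin (N + 1) → ℕ}
    {p : Fin (N + 1)} (hb : Monotone b) (hp : ∀ x, b x = b p → x = p) :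
    Nat.card {π : Equiv.Perm (Fin (N + 1)) // IsCyclic' π ∧ StrictMonoOnFibers b π} =
      Nat.card (rearrangements b p) := by
  have hmem : ∀ π : {π : Equiv.Perm (Fin (N + 1)) // IsCyclic' π ∧ StrictMonoOnFibers b π},
      (fun i : Fin (N + 1) => b ((π.1 ^ (i : ℕ)) p)) ∈ rearrangements b p := by
    rintro ⟨π, hπ, -⟩
    obtain ⟨e, he, -⟩ := hπ.exists_semiconj_finRotate p
    exact ⟨by simp, e, funext fun i => by simp [he]⟩
  refine Nat.card_congr (Equiv.ofBijective (fun π => ⟨_, hmem π⟩) ⟨?_, ?_⟩)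
  · rintro ⟨π, hπ, hπb⟩ ⟨τ, hτ, hτb⟩ h
    obtain ⟨e, he, hec⟩ := hπ.exists_semiconj_finRotate p
    obtain ⟨f, hf, hfc⟩ := hτ.exists_semiconj_finRotate p
    have hbe : b ∘ e = fun i : Fin (N + 1) => b ((π ^ (i : ℕ)) p) :=
      funext fun i => by simp [he]
    have hbf : b ∘ f = fun i : Fin (N + 1) => b ((τ ^ (i : ℕ)) p) :=
      funext fun i => by simp [hf]
    have hef : b ∘ e = b ∘ f := by rw [hbe, hbf]; exact congrArg Subtype.val h
    have aux : ∀ (ρ g : Equiv.Perm (Fin (N + 1))), StrictMonoOnFibers b ρ →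
        (∀ (k : ℕ) (i : Fin (N + 1)), g ((finRotate (N + 1) ^ k) i) = (ρ ^ k) (g i)) →
        Monotone (itinerary (finRotate (N + 1)) (b ∘ g) ∘ g.symm) := by
      intro ρ g hρ hg
      convert itinerary_monotone hb hρ using 1
      funext x
      simp [itinerary, hg]
    have hsymm : e.symm = f.symm :=
      eq_of_monotone_comp_perm (itinerary_finRotate_injective hp (hbe ▸ hmem ⟨π, hπ, hπb⟩))
        (aux π e hπb hec) (hef ▸ aux τ f hτb hfc)
    have heq : e = f := by rw [← e.symm_symm, hsymm, f.symm_symm]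
    refine Subtype.ext (Equiv.ext fun x => ?_)
    have h₁ := hec 1 (e.symm x)
    have h₂ := hfc 1 (e.symm x)
    rw [← heq, h₁] at h₂
    simpa using h₂
  · rintro ⟨w, hw⟩
    obtain ⟨h₀, e, he⟩ := id hw
    let key := itinerary (finRotate (N + 1)) w
    set s := Tuple.sort key
    have hs : w ∘ s = b :=
      comp_sort_eq_of_monotone hb he fun i j hij => apply_le_of_itinerary_le hij
    have hs' : ∀ x, w (s x) = b x := congrFun hs
    have hmono : StrictMono (key ∘ s) :=
      (Tuple.monotone_sort key).strictMono_of_injective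
        ((itinerary_finRotate_injective hp hw).comp s.injective)
    have hsp : s p = 0 := eq_zero_of_mem_rearrangements hp hw ((hs' p).trans h₀.symm)
    have hpow : ∀ (k : ℕ) (x : Fin (N + 1)),
        ((s⁻¹ * finRotate (N + 1) * s) ^ k) x = s.symm ((finRotate (N + 1) ^ k) (s x)) := by
      intro k x
      have := conj_pow (a := s⁻¹) (b := finRotate (N + 1)) (i := k)
      rw [inv_inv] at this
      rw [this]
      rfl
    refine ⟨⟨s⁻¹ * finRotate (N + 1) * s, ?_, ?_⟩, Subtype.ext ?_⟩
    · intro x y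
      obtain ⟨k, hk⟩ := isCyclic'_finRotate N (s x) (s y)
      exact ⟨k, by rw [hpow, hk, s.symm_apply_apply]⟩
    · intro x y hxy hbxy
      have h := itinerary_apply_lt (hmono hxy) (by rw [hs', hs', hbxy])
      rw [← hmono.lt_iff_lt]
      change key (s (s.symm _)) < key (s (s.symm _))
      rw [s.apply_symm_apply, s.apply_symm_apply]
      exact h
    · funext i
      have : (finRotate (N + 1) ^ (i : ℕ)) 0 = i := by
        ext
        simp [finRotate_pow_val, Nat.mod_eq_of_lt i.isLt]
      simp only [hpow, hsp, this, ← hs', s.apply_symm_apply]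

theorem card_filter_subset_eq_sum {α γ : Type*} [Fintype α] [DecidableEq γ]
    (d : α → Finset γ) (I : Finset γ) :
    (Finset.univ.filter fun a => d a ⊆ I).card =
      ∑ K ∈ I.powerset, (Finset.univ.filter fun a => d a = K).card := by
  rw [Finset.card_eq_sum_card_fiberwise (f := d) (t := I.powerset) (by intro a; simp)]
  refine Finset.sum_congr rfl fun K hK => ?_
  congr 1
  ext a
  simp only [Finset.mem_filter, Finset.mem_univ, true_and, and_iff_right_iff_imp]
  rintro rfl
  exact Finset.mem_powerset.1 hK

theorem card_subtype_eq_of_card_subtype_subset_eq {α β γ : Type*} [Finite α] [Finite β]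
    [DecidableEq γ] {f : α → Finset γ} {g : β → Finset γ}
    (h : ∀ I, Nat.card {a // f a ⊆ I} = Nat.card {b // g b ⊆ I}) (I : Finset γ) :
    Nat.card {a // f a = I} = Nat.card {b // g b = I} := by
  have := Fintype.ofFinite α
  have := Fintype.ofFinite β
  simp only [Nat.card_eq_fintype_card, Fintype.card_subtype] at h ⊢
  induction I using Finset.strongInduction with
  | H I ih =>
    have hI := h I
    have hα := card_filter_subset_eq_sum f I
    have hβ := card_filter_subset_eq_sum g I
    rw [← Finset.add_sum_erase _ _ (Finset.mem_powerset_self I)] at hα hβ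
    have hsum := Finset.sum_congr rfl fun K (hK : K ∈ I.powerset.erase I) =>
      ih K (Finset.mem_ssubsets.1 hK)
    omega

theorem mem_descSet {n : ℕ} {σ : Equiv.Perm (Fin n)} {i : ℕ} :
    i ∈ descSet σ ↔ ∃ h : i + 1 < n, σ ⟨i + 1, h⟩ < σ ⟨i, Nat.lt_of_succ_lt h⟩ := by
  simp only [descSet, descSeq, Finset.mem_filter, Finset.mem_range, Fin.val_fin_lt,
    and_iff_right_iff_imp]
  rintro ⟨h, -⟩
  omega

/-- The descents of `σ` avoid `K` if and only if `σ` increases along the blocks of consecutive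
positions joined by `K`. -/
theorem disjoint_descSet_iff {n : ℕ} {σ : Equiv.Perm (Fin n)} {K : Finset ℕ} :
    Disjoint (descSet σ) K ↔
      StrictMonoOnFibers (fun x => Nat.count (fun i => i ∉ K) x) σ := by
  rw [Finset.disjoint_left]
  constructor
  · intro h
    have key : ∀ (d x : ℕ) (hx : x + d + 1 < n),
        Nat.count (fun i => i ∉ K) x = Nat.count (fun i => i ∉ K) (x + d + 1) →
        σ ⟨x, by omega⟩ < σ ⟨x + d + 1, hx⟩ := by
      intro d
      induction d with
      | zero =>
        intro x hx hc
        have hxK : x ∈ K := by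
          by_contra hxK
          simp [Nat.count_succ, hxK] at hc
        have hnd : x ∉ descSet σ := fun hd => h hd hxK
        rw [mem_descSet] at hnd
        push Not at hnd
        exact lt_of_le_of_ne (hnd hx) fun he => by simpa using σ.injective he
      | succ d ih =>
        intro x hx hc
        have h₁ := Nat.count_monotone (fun i => i ∉ K) (show x ≤ x + d + 1 by omega)
        have h₂ := Nat.count_monotone (fun i => i ∉ K)
          (show x + d + 1 ≤ x + (d + 1) + 1 by omega)
        have hxK : x + d + 1 ∈ K := by
          by_contra hxK
          rw [show x + (d + 1) + 1 = (x + d + 1) + 1 by omega, Nat.count_succ] at hc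
          simp only [hxK, not_false_eq_true, if_true] at hc
          omega
        have hnd : x + d + 1 ∉ descSet σ := fun hd => h hd hxK
        rw [mem_descSet] at hnd
        push Not at hnd
        exact (ih x (by omega) (by omega)).trans
          (lt_of_le_of_ne (hnd hx) fun he => by simpa using σ.injective he)
    intro x y hxy hc
    obtain ⟨d, hd⟩ := Nat.exists_eq_add_of_lt (show (x : ℕ) < y from hxy)
    have := key d x (hd ▸ y.isLt) (hd ▸ hc)
    simpa [← hd] using this
  · intro h i hi hiK
    obtain ⟨hin, hlt⟩ := mem_descSet.1 hi
    exact absurd (h (x := ⟨i, by omega⟩) (y := ⟨i + 1, hin⟩) (by simp)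
      (by simp [Nat.count_succ, hiK])) hlt.asymm

theorem count_notMem_eq_iff {K : Finset ℕ} {p x : ℕ} (h₁ : p ∉ K)
    (h₂ : p - 1 ∉ K) :
    Nat.count (fun i => i ∉ K) x = Nat.count (fun i => i ∉ K) p ↔ x = p := by
  refine ⟨fun h => ?_, fun h => by rw [h]⟩
  rcases lt_trichotomy x p with hx | hx | hx
  · have h₃ := Nat.count_monotone (fun i => i ∉ K) (show x ≤ p - 1 by omega)
    have h₄ := Nat.count_succ (fun i => i ∉ K) (p - 1)
    rw [if_pos h₂, Nat.sub_add_cancel (by omega)] at h₄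
    omega
  · exact hx
  · have h₃ := Nat.count_monotone (fun i => i ∉ K) (show p + 1 ≤ x by omega)
    have h₄ := Nat.count_succ (fun i => i ∉ K) p
    rw [if_pos h₁] at h₄
    omega

theorem stmt9 (n m : ℕ) (hm1 : 1 ≤ m) (hmn : m ≤ n)
    (J : Finset ℕ) (hJ : J = Finset.range (n - 1) \ {m - 2, m - 1})
    (I : Finset ℕ) (hI : I ⊆ J) :
    Nat.card {π : Equiv.Perm (Fin n) // IsCyclic' π ∧ descSet π ∩ J = I}
      = Nat.card {σ : Equiv.Perm (Fin n) //
          (σ ⟨m - 1, Nat.lt_of_lt_of_le (Nat.sub_lt hm1 Nat.one_pos) hmn⟩ : ℕ) = 0 ∧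
          descSet σ ∩ J = I} := by
  obtain ⟨N, rfl⟩ : ∃ N, n = N + 1 := ⟨n - 1, by omega⟩
  set p : Fin (N + 1) := ⟨m - 1, Nat.lt_of_lt_of_le (Nat.sub_lt hm1 Nat.one_pos) hmn⟩ with hp
  have hsub : ∀ (σ : Equiv.Perm (Fin (N + 1))) (L : Finset ℕ), descSet σ ∩ J ⊆ L ↔
      StrictMonoOnFibers (fun x => Nat.count (fun i => i ∉ J \ L) x) σ := by
    intro σ L
    rw [← disjoint_descSet_iff, Finset.disjoint_left, Finset.subset_iff]
    simp only [Finset.mem_inter, Finset.mem_sdiff, not_and, not_not, and_imp]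
  have key := card_subtype_eq_of_card_subtype_subset_eq
    (f := fun π : {π : Equiv.Perm (Fin (N + 1)) // IsCyclic' π} => descSet π.1 ∩ J)
    (g := fun σ : {σ : Equiv.Perm (Fin (N + 1)) // σ p = 0} => descSet σ.1 ∩ J) ?_ I
  · rw [Nat.card_congr (Equiv.subtypeSubtypeEquivSubtypeInter _ fun π => descSet π ∩ J = I),
      Nat.card_congr (Equiv.subtypeSubtypeEquivSubtypeInter _ fun σ => descSet σ ∩ J = I)] at key
    simpa only [Fin.val_eq_zero_iff] using key
  · intro L
    rw [Nat.card_congr (Equiv.subtypeSubtypeEquivSubtypeInter _ fun π => descSet π ∩ J ⊆ L),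
      Nat.card_congr (Equiv.subtypeSubtypeEquivSubtypeInter _ fun σ => descSet σ ∩ J ⊆ L)]
    simp only [hsub]
    have hb : Monotone fun x : Fin (N + 1) => Nat.count (fun i => i ∉ J \ L) x :=
      fun x y hxy => Nat.count_monotone _ hxy
    have hbp : ∀ x : Fin (N + 1), Nat.count (fun i => i ∉ J \ L) x =
        Nat.count (fun i => i ∉ J \ L) p → x = p := fun x hx =>
      Fin.ext ((count_notMem_eq_iff (by simp [hJ, hp])
        (by simp [hJ, hp, Nat.sub_sub])).1 hx)
    rw [card_isCyclic'_eq_card_rearrangements hb hbp,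
      card_strictMonoOnFibers_eq_card_rearrangements hb hbp]
end

section
/- For any two subsets I, J ⊆ {1,...,n−1} with the same associated partition of n, the number of derangements of {1,...,n} with descent set contained in I equals the number of derangements with descent set contained in J. -/
namespace DerangementDescents

variable {ι : Type*} {n : ℕ}

/-- Two functions with equinumerous fibres differ by a permutation of the domain, which can be
chosen increasing on each fibre. -/
lemma exists_perm_strictMono_on_fibers {α β : Type*} [LinearOrder α] [Fintype α] [DecidableEq β]
    (f g : α → β)
    (h : ∀ v, (Finset.univ.filter (f · = v)).card = (Finset.univ.filter (g · = v)).card) :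
    ∃ τ : Equiv.Perm α, (∀ x, g (τ x) = f x) ∧ ∀ x y, x < y → f x = f y → τ x < τ y := by
  have key : ∀ v, ∃ φ : α → α, (∀ x y, f x = v → f y = v → x < y → φ x < φ y) ∧
      ∀ x, f x = v → g (φ x) = v := by
    intro v
    let e := ((Finset.univ.filter (f · = v)).orderIsoOfFin rfl).symm.trans
      ((Finset.univ.filter (g · = v)).orderIsoOfFin (h v).symm)
    refine ⟨fun x => if hx : f x = v then e ⟨x, by simp [hx]⟩ else x, ?_, ?_⟩
    · intro x y hx hy hxy
      simp only [hx, hy, dite_true]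
      exact e.strictMono (show (⟨x, _⟩ : {z // z ∈ Finset.univ.filter (f · = v)}) < ⟨y, _⟩ from hxy)
    · intro x hx
      simp only [hx, dite_true]
      exact (Finset.mem_filter.1 (e ⟨x, by simp [hx]⟩).2).2
  choose φ hφ hg using key
  have mono : ∀ x y, x < y → f x = f y → φ (f x) x < φ (f y) y := fun x y hxy he => by
    rw [← he]; exact hφ _ _ _ rfl he.symm hxy
  have inj : Function.Injective fun x => φ (f x) x := by
    intro x y hxy
    have he : f x = f y := by
      rw [← hg (f x) x rfl, ← hg (f y) y rfl]
      exact congrArg g hxy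
    rcases lt_trichotomy x y with hlt | heq | hlt
    · exact absurd hxy (mono _ _ hlt he).ne
    · exact heq
    · exact absurd hxy (mono _ _ hlt he.symm).ne'
  exact ⟨Equiv.ofBijective _ (Finite.injective_iff_bijective.1 inj), fun x => hg _ _ rfl, mono⟩

/-- Every fibre of `b` is an interval. -/
def IntervalFibers (b : Fin n → ι) : Prop :=
  ∀ x y z, x ≤ y → y ≤ z → b x = b z → b y = b x

/-- The permutations that are increasing on each fibre of `b` and have no fixed point whose
label lies in `T`. -/
def fiberPerms (b : Fin n → ι) (T : Set ι) : Set (Equiv.Perm (Fin n)) :=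
  {π | (∀ x y, x < y → b x = b y → π x < π y) ∧ ∀ x, b x ∈ T → π x ≠ x}

/-- The permutation fixing `p` and acting as `σ` on the other points. -/
def insertFixed (p : Fin (n + 1)) (σ : Equiv.Perm (Fin n)) : Equiv.Perm (Fin (n + 1)) :=
  (finSuccEquiv' p).symm.permCongr σ.optionCongr

@[simp] lemma insertFixed_self (p : Fin (n + 1)) (σ : Equiv.Perm (Fin n)) :
    insertFixed p σ p = p := by
  simp [insertFixed, Equiv.permCongr_apply]

@[simp] lemma insertFixed_succAbove (p : Fin (n + 1)) (σ : Equiv.Perm (Fin n)) (x : Fin n) :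
    insertFixed p σ (p.succAbove x) = p.succAbove (σ x) := by
  simp [insertFixed, Equiv.permCongr_apply]

lemma exists_insertFixed_eq {p : Fin (n + 1)} {π : Equiv.Perm (Fin (n + 1))} (h : π p = p) :
    ∃ σ, insertFixed p σ = π := by
  have hne : ∀ x, ∃ y, p.succAbove y = π (p.succAbove x) := fun x =>
    Fin.exists_succAbove_eq fun hx => Fin.succAbove_ne p x (π.injective (hx.trans h.symm))
  choose s hs using hne
  have inj : Function.Injective s := fun x y hxy =>
    Fin.succAbove_right_injective (π.injective (by rw [← hs, ← hs, hxy]))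
  refine ⟨Equiv.ofBijective s (Finite.injective_iff_bijective.1 inj), Equiv.ext fun x => ?_⟩
  rcases eq_or_ne x p with rfl | hx
  · simp [h]
  · obtain ⟨y, rfl⟩ := Fin.exists_succAbove_eq hx
    simpa using hs y

lemma IntervalFibers.comp_succAbove {b : Fin (n + 1) → ι} (hb : IntervalFibers b)
    (p : Fin (n + 1)) : IntervalFibers (b ∘ p.succAbove) := fun _ _ _ hxy hyz he =>
  hb _ _ _ ((Fin.strictMono_succAbove p).monotone hxy) ((Fin.strictMono_succAbove p).monotone hyz) he

lemma val_succAbove (p : Fin (n + 1)) (x : Fin n) :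
    (p.succAbove x : ℕ) = if (x : ℕ) < p then (x : ℕ) else x + 1 := by
  rw [Fin.succAbove]
  split_ifs <;> simp_all [Fin.lt_def]

/-- Deleting either of two points of the same fibre yields the same labelling. -/
lemma IntervalFibers.comp_succAbove_eq {b : Fin (n + 1) → ι} (hb : IntervalFibers b)
    {p q : Fin (n + 1)} (h : b p = b q) : b ∘ p.succAbove = b ∘ q.succAbove := by
  wlog hpq : p ≤ q generalizing p q
  · exact (this h.symm (le_of_not_ge hpq)).symm
  funext x
  have h1 := val_succAbove p x
  have h2 := val_succAbove q x
  simp only [Function.comp_apply]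
  by_cases hx : p.succAbove x = q.succAbove x
  · rw [hx]
  · have hx' : (p.succAbove x : ℕ) ≠ q.succAbove x := fun h => hx (Fin.ext h)
    rw [Fin.le_def] at hpq
    rw [hb p (p.succAbove x) q (Fin.le_def.2 (by split_ifs at * <;> omega))
      (Fin.le_def.2 (by split_ifs at * <;> omega)) h,
      hb p (q.succAbove x) q (Fin.le_def.2 (by split_ifs at * <;> omega))
      (Fin.le_def.2 (by split_ifs at * <;> omega)) h]

/-- A strictly increasing self-map of an interval of integers is the identity. -/
lemma eq_self_of_strictMono_between {m : ℕ} (f : Fin m → Fin m) (a c : ℕ)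
    (hf : ∀ x y : Fin m, a ≤ x → (y : ℕ) ≤ c → x < y → f x < f y)
    (hmaps : ∀ x : Fin m, a ≤ x → (x : ℕ) ≤ c → a ≤ f x ∧ (f x : ℕ) ≤ c)
    (x : Fin m) (hax : a ≤ x) (hxc : (x : ℕ) ≤ c) : f x = x := by
  have lo : ∀ k (hk : k < m), a ≤ k → k ≤ c → k ≤ (f ⟨k, hk⟩ : ℕ) := by
    intro k
    induction k with
    | zero => intros; omega
    | succ k ih =>
      intro hk hak hkc
      rcases Nat.lt_or_ge k a with hka | hka
      · have := (hmaps ⟨k + 1, hk⟩ hak hkc).1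
        omega
      · have h1 := ih (by omega) hka (by omega)
        have h2 := hf ⟨k, by omega⟩ ⟨k + 1, hk⟩ hka hkc (Fin.lt_def.2 (by simp))
        rw [Fin.lt_def] at h2
        omega
  have hi : ∀ d k (hk : k < m), k + d = c → a ≤ k → (f ⟨k, hk⟩ : ℕ) ≤ k := by
    intro d
    induction d with
    | zero =>
      intro k hk hkc hak
      have := (hmaps ⟨k, hk⟩ hak (by simp; omega)).2
      omega
    | succ d ih =>
      intro k hk hkc hak
      by_cases hk' : k + 1 < m
      · have h1 := ih (k + 1) hk' (by omega) (by omega)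
        have h2 := hf ⟨k, hk⟩ ⟨k + 1, hk'⟩ hak (by simp; omega) (Fin.lt_def.2 (by simp))
        rw [Fin.lt_def] at h2
        omega
      · have := (f ⟨k, hk⟩).2
        omega
  have h1 := lo x x.2 hax hxc
  have h2 := hi (c - x) x x.2 (by omega) hax
  exact Fin.ext (le_antisymm h2 h1)

section Insertion

variable {b : Fin (n + 1) → ι} {T : Set ι}

lemma mem_fiberPerms_of_insertFixed {p : Fin (n + 1)} {σ : Equiv.Perm (Fin n)}
    (h : insertFixed p σ ∈ fiberPerms b T) : σ ∈ fiberPerms (b ∘ p.succAbove) T := by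
  refine ⟨fun x y hxy he => ?_, fun x hx hfix => ?_⟩
  · have := h.1 _ _ (Fin.succAbove_lt_succAbove_iff (p := p).2 hxy) he
    simpa using this
  · exact h.2 _ hx (by simp [hfix])

/-- The fixed points of a fibrewise increasing permutation inside one fibre are contiguous. -/
lemma eq_self_of_between_fixed (hb : IntervalFibers b) {π : Equiv.Perm (Fin (n + 1))} (hπ : π ∈ fiberPerms b T)
    {p q x : Fin (n + 1)} (hpq : b p = b q) (hp : π p = p) (hq : π q = q)
    (hpx : p ≤ x) (hxq : x ≤ q) : π x = x := by
  have hlab : ∀ y : Fin (n + 1), (p : ℕ) ≤ y → (y : ℕ) ≤ q → b y = b p := fun y h1 h2 =>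
    hb p y q h1 h2 hpq
  have hmono : ∀ x y : Fin (n + 1), (p : ℕ) ≤ x → (y : ℕ) ≤ q → x < y → π x < π y :=
    fun x y hx hy hxy => hπ.1 x y hxy (by
      rw [Fin.lt_def] at hxy
      rw [hlab x hx (by omega), hlab y (by omega) hy])
  refine eq_self_of_strictMono_between π p q hmono (fun y h1 h2 => ⟨?_, ?_⟩) x hpx hxq
  · rcases eq_or_lt_of_le (show p ≤ y from h1) with rfl | hlt
    · exact hp.symm.le
    · have := hmono p y le_rfl h2 hlt
      rw [hp] at this
      exact this.le
  · rcases eq_or_lt_of_le (show y ≤ q from h2) with rfl | hlt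
    · exact hq.le
    · have := hmono y q h1 le_rfl hlt
      rw [hq] at this
      exact this.le

lemma insertFixed_right_unique (hb : IntervalFibers b) {p q : Fin (n + 1)}
    {σ ρ : Equiv.Perm (Fin n)} (hpq : b p = b q)
    (h : insertFixed p σ ∈ fiberPerms b T) (he : insertFixed p σ = insertFixed q ρ) : σ = ρ := by
  wlog hle : p ≤ q generalizing p q σ ρ
  · exact (this hpq.symm (he ▸ h) he.symm (le_of_not_ge hle)).symm
  have hfix : ∀ x : Fin (n + 1), p ≤ x → x ≤ q → insertFixed p σ x = x := fun x =>
    eq_self_of_between_fixed hb h hpq (insertFixed_self _ _) (by rw [he, insertFixed_self])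
  refine Equiv.ext fun x => Fin.ext ?_
  rw [Fin.le_def] at hle
  by_cases hx : p.succAbove x = q.succAbove x
  · have h1 : p.succAbove (σ x) = q.succAbove (ρ x) := by
      rw [← insertFixed_succAbove, ← insertFixed_succAbove, ← he, hx]
    have h2 := val_succAbove p (σ x)
    have h3 := val_succAbove q (ρ x)
    rw [h1] at h2
    by_cases hmid : p ≤ q.succAbove (ρ x) ∧ q.succAbove (ρ x) ≤ q
    · have h4 := hfix _ hmid.1 hmid.2
      have h5 : insertFixed p σ (p.succAbove x) = q.succAbove (ρ x) := by
        rw [insertFixed_succAbove, h1]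
      have h5 := (insertFixed p σ).injective (h4.trans h5.symm)
      have h6 := val_succAbove p x
      have h7 := val_succAbove q x
      rw [← hx, ← h5] at h7
      rw [← h5] at h6
      simp only [Fin.le_def] at hmid
      split_ifs at * <;> omega
    · simp only [Fin.le_def] at hmid
      split_ifs at * <;> omega
  · have hx' : (p.succAbove x : ℕ) ≠ q.succAbove x := fun h => hx (Fin.ext h)
    have h1 := val_succAbove p x
    have h2 := val_succAbove q x
    have h3 := hfix (p.succAbove x) (Fin.le_def.2 (by split_ifs at * <;> omega))
      (Fin.le_def.2 (by split_ifs at * <;> omega))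
    have h4 := hfix (q.succAbove x) (Fin.le_def.2 (by split_ifs at * <;> omega))
      (Fin.le_def.2 (by split_ifs at * <;> omega))
    rw [insertFixed_succAbove] at h3
    rw [he, insertFixed_succAbove] at h4
    rw [Fin.succAbove_right_injective h3, Fin.succAbove_right_injective h4]


/-- Inserting a fixed point into a fibrewise increasing permutation. -/
lemma insertFixed_mem_fiberPerms {p : Fin (n + 1)} {σ : Equiv.Perm (Fin n)}
    (hp : b p ∉ T) (hσ : σ ∈ fiberPerms (b ∘ p.succAbove) T)
    (h : ∀ x, b (p.succAbove x) = b p → ((x : ℕ) < p ↔ (σ x : ℕ) < p)) :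
    insertFixed p σ ∈ fiberPerms b T := by
  refine ⟨fun x y hxy he => ?_, fun x hx hfix => ?_⟩
  · rcases eq_or_ne x p with rfl | hxp
    · obtain ⟨y, rfl⟩ := Fin.exists_succAbove_eq hxy.ne'
      have h1 := h y he.symm
      have h2 := val_succAbove x y
      have h3 := val_succAbove x (σ y)
      rw [insertFixed_self, insertFixed_succAbove]
      rw [Fin.lt_def] at *
      split_ifs at * <;> omega
    · obtain ⟨x, rfl⟩ := Fin.exists_succAbove_eq hxp
      rcases eq_or_ne y p with rfl | hyp
      · have h1 := h x he
        have h2 := val_succAbove y x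
        have h3 := val_succAbove y (σ x)
        rw [insertFixed_self, insertFixed_succAbove]
        rw [Fin.lt_def] at *
        split_ifs at * <;> omega
      · obtain ⟨y, rfl⟩ := Fin.exists_succAbove_eq hyp
        rw [insertFixed_succAbove, insertFixed_succAbove, Fin.succAbove_lt_succAbove_iff]
        exact hσ.1 x y (Fin.succAbove_lt_succAbove_iff.1 hxy) he
  · rcases eq_or_ne x p with rfl | hxp
    · exact hp hx
    · obtain ⟨x, rfl⟩ := Fin.exists_succAbove_eq hxp
      rw [insertFixed_succAbove] at hfix
      exact hσ.2 x hx (Fin.succAbove_right_injective hfix)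

lemma lt_iff_of_insertFixed_mem {p : Fin (n + 1)} {σ : Equiv.Perm (Fin n)}
    (h : insertFixed p σ ∈ fiberPerms b T) (x : Fin n) (hx : b (p.succAbove x) = b p) :
    (x : ℕ) < p ↔ (σ x : ℕ) < p := by
  have h2 := val_succAbove p x
  have h3 := val_succAbove p (σ x)
  rcases lt_or_gt_of_ne (Fin.succAbove_ne p x) with hlt | hlt
  · have h1 := h.1 _ _ hlt hx
    rw [insertFixed_self, insertFixed_succAbove] at h1
    rw [Fin.lt_def] at *
    split_ifs at * <;> omega
  · have h1 := h.1 _ _ hlt hx.symm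
    rw [insertFixed_self, insertFixed_succAbove] at h1
    rw [Fin.lt_def] at *
    split_ifs at * <;> omega

lemma insertFixed_left_unique (hb : IntervalFibers b) {p q : Fin (n + 1)}
    {σ : Equiv.Perm (Fin n)} (hpq : b p = b q) (hp : insertFixed p σ ∈ fiberPerms b T)
    (hq : insertFixed q σ ∈ fiberPerms b T) : insertFixed p σ = insertFixed q σ := by
  wlog hle : p ≤ q generalizing p q
  · exact (this hpq.symm hq hp (le_of_not_ge hle)).symm
  have hσ := (mem_fiberPerms_of_insertFixed hp).1
  have hlabp : ∀ x : Fin n, (p : ℕ) ≤ x → (x : ℕ) < q → b (p.succAbove x) = b p := by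
    intro x h1 h2
    have h3 := val_succAbove p x
    refine hb p _ q (Fin.le_def.2 ?_) (Fin.le_def.2 ?_) hpq <;> split_ifs at * <;> omega
  have hlabq : ∀ x : Fin n, (p : ℕ) ≤ x → (x : ℕ) < q → b (q.succAbove x) = b q := fun x h1 h2 => by
    rw [← hpq, ← hlabp x h1 h2]
    exact (congrFun (hb.comp_succAbove_eq hpq) x).symm
  have hfix : ∀ x : Fin n, (p : ℕ) ≤ x → (x : ℕ) < q → σ x = x := by
    intro x h1 h2
    refine eq_self_of_strictMono_between σ p (q - 1) (fun x y hx hy hxy => ?_)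
      (fun y hy1 hy2 => ?_) x h1 (by omega)
    · rw [Fin.lt_def] at hxy
      exact hσ x y hxy ((hlabp x hx (by omega)).trans (hlabp y (by omega) (by omega)).symm)
    · have h3 := lt_iff_of_insertFixed_mem hp y (hlabp y hy1 (by omega))
      have h4 := lt_iff_of_insertFixed_mem hq y (hlabq y hy1 (by omega))
      omega
  have hinv : ∀ x : Fin n, (p : ℕ) ≤ σ x → (σ x : ℕ) < q → σ x = x := fun x h1 h2 =>
    σ.injective (hfix _ h1 h2)
  have hfixp : ∀ y : Fin (n + 1), p ≤ y → y ≤ q → insertFixed p σ y = y := by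
    intro y h1 h2
    rcases eq_or_ne y p with rfl | hy
    · simp
    · obtain ⟨x, rfl⟩ := Fin.exists_succAbove_eq hy
      have h3 := val_succAbove p x
      rw [Fin.le_def] at h1 h2
      rw [insertFixed_succAbove, hfix x (by split_ifs at * <;> omega) (by split_ifs at * <;> omega)]
  have hfixq : ∀ y : Fin (n + 1), p ≤ y → y ≤ q → insertFixed q σ y = y := by
    intro y h1 h2
    rcases eq_or_ne y q with rfl | hy
    · simp
    · obtain ⟨x, rfl⟩ := Fin.exists_succAbove_eq hy
      have h3 := val_succAbove q x
      rw [Fin.le_def] at h1 h2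
      rw [insertFixed_succAbove, hfix x (by split_ifs at * <;> omega) (by split_ifs at * <;> omega)]
  refine Equiv.ext fun y => ?_
  by_cases hy : p ≤ y ∧ y ≤ q
  · rw [hfixp y hy.1 hy.2, hfixq y hy.1 hy.2]
  · obtain ⟨x, rfl⟩ := Fin.exists_succAbove_eq (x := y) (y := p) (by rintro rfl; simp [hle] at hy)
    have h1 := val_succAbove p x
    have h2 := val_succAbove q x
    have h3 := val_succAbove p (σ x)
    have h4 := val_succAbove q (σ x)
    have h5 := hinv x
    rw [Fin.le_def] at hle
    simp only [Fin.le_def] at hy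
    have h6 : p.succAbove x = q.succAbove x := Fin.ext (by split_ifs at * <;> omega)
    rw [insertFixed_succAbove, h6, insertFixed_succAbove]
    by_cases h7 : (p : ℕ) ≤ σ x ∧ (σ x : ℕ) < q
    · rw [h5 h7.1 h7.2, h6]
    · exact Fin.ext (by split_ifs at * <;> omega)

/-- A fixed point can be inserted into any nonempty fibre. -/
lemma exists_insertFixed_mem (hb : IntervalFibers b) (p₀ : Fin (n + 1)) {σ : Equiv.Perm (Fin n)}
    (hp₀ : b p₀ ∉ T) (hσ : σ ∈ fiberPerms (b ∘ p₀.succAbove) T) :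
    ∃ p, b p = b p₀ ∧ insertFixed p σ ∈ fiberPerms b T := by
  classical
  let S : Finset (Fin (n + 1)) := Finset.univ.filter fun q => b q = b p₀ ∧
    ∀ x : Fin n, b (p₀.succAbove x) = b p₀ → (q : ℕ) ≤ x → (q : ℕ) ≤ σ x
  have hlab : ∀ {q}, b q = b p₀ → ∀ x, b (q.succAbove x) = b (p₀.succAbove x) := fun hq x =>
    congrFun (hb.comp_succAbove_eq hq) x
  have hS : S.Nonempty := by
    obtain ⟨q, hq, hmax⟩ := (Finset.univ.filter fun q => b q = b p₀).exists_max_image id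
      ⟨p₀, by simp⟩
    simp only [Finset.mem_filter, Finset.mem_univ, true_and, id] at hq hmax
    refine ⟨q, by
      simp only [S, Finset.mem_filter, Finset.mem_univ, true_and]
      refine ⟨hq, fun x hx hle => ?_⟩
      have h1 := hmax _ ((hlab hq x).trans hx)
      have h2 := val_succAbove q x
      rw [Fin.le_def] at h1
      split_ifs at * <;> omega⟩
  obtain ⟨p, hpS, hmin⟩ := S.exists_min_image id hS
  simp only [S, Finset.mem_filter, Finset.mem_univ, true_and, id] at hpS hmin
  refine ⟨p, hpS.1, insertFixed_mem_fiberPerms (by rwa [hpS.1])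
    (by rwa [hb.comp_succAbove_eq hpS.1]) fun x hx => ?_⟩
  have hx₀ := hx
  rw [hlab hpS.1, hpS.1] at hx₀
  by_cases hxp : (x : ℕ) < p
  · refine iff_of_true hxp ?_
    by_contra hcon
    have hcast : p.succAbove x = x.castSucc := Fin.ext (by
      rw [val_succAbove, if_pos hxp, Fin.val_castSucc])
    have := hmin x.castSucc ⟨by rw [← hcast, hx, hpS.1], fun y hy hxy => ?_⟩
    · rw [Fin.le_def, Fin.val_castSucc] at this
      omega
    · rw [Fin.val_castSucc] at hxy ⊢
      rcases eq_or_lt_of_le (show x ≤ y from hxy) with rfl | hlt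
      · omega
      · have := hσ.1 x y hlt (hx₀.trans hy.symm)
        rw [Fin.lt_def] at this
        omega
  · have := hpS.2 x hx₀ (by omega)
    omega

lemma ncard_fiberPerms_fixed (hb : IntervalFibers b) (p₀ : Fin (n + 1)) (hp₀ : b p₀ ∉ T) :
    (fiberPerms b T ∩ {π | ∃ x, b x = b p₀ ∧ π x = x}).ncard
      = (fiberPerms (b ∘ p₀.succAbove) T).ncard := by
  choose! F hF using fun σ (hσ : σ ∈ fiberPerms (b ∘ p₀.succAbove) T) =>
    exists_insertFixed_mem hb p₀ hp₀ hσ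
  symm
  refine Set.ncard_congr (fun σ _ => insertFixed (F σ) σ)
    (fun σ hσ => ⟨(hF σ hσ).2, F σ, (hF σ hσ).1, insertFixed_self _ _⟩)
    (fun σ ρ hσ hρ he => insertFixed_right_unique hb ((hF σ hσ).1.trans (hF ρ hρ).1.symm)
      (hF σ hσ).2 he) ?_
  rintro π ⟨hπ, p, hp, hfix⟩
  obtain ⟨σ, rfl⟩ := exists_insertFixed_eq hfix
  have hσ : σ ∈ fiberPerms (b ∘ p₀.succAbove) T := by
    rw [← hb.comp_succAbove_eq hp]
    exact mem_fiberPerms_of_insertFixed hπ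
  exact ⟨σ, hσ, insertFixed_left_unique hb ((hF σ hσ).1.trans hp.symm) (hF σ hσ).2 hπ⟩

end Insertion

lemma ncard_fiberPerms_empty [DecidableEq ι] (b c : Fin n → ι)
    (h : ∀ v, (Finset.univ.filter (b · = v)).card = (Finset.univ.filter (c · = v)).card) :
    (fiberPerms b ∅).ncard = (fiberPerms c ∅).ncard := by
  have le : ∀ b c : Fin n → ι,
      (∀ v, (Finset.univ.filter (b · = v)).card = (Finset.univ.filter (c · = v)).card) →
      (fiberPerms b ∅).ncard ≤ (fiberPerms c ∅).ncard := by
    intro b c h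
    obtain ⟨τ, hτ, hmono⟩ := exists_perm_strictMono_on_fibers c b fun v => (h v).symm
    refine Set.ncard_le_ncard_of_injOn (· * τ) (fun π hπ => ⟨fun x y hxy he => ?_, by simp⟩)
      ((mul_left_injective τ).injOn) (Set.toFinite _)
    exact hπ.1 _ _ (hmono x y hxy he) (by rw [hτ, hτ, he])
  exact le_antisymm (le b c h) (le c b fun v => (h v).symm)

lemma fiberPerms_insert (b : Fin n → ι) (i : ι) (T : Set ι) :
    fiberPerms b (insert i T) = fiberPerms b T \ {π | ∃ x, b x = i ∧ π x = x} := by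
  ext π
  simp only [fiberPerms, Set.mem_ofPred_eq, Set.mem_insert_iff, Set.mem_sdiff, not_exists, not_and]
  grind

lemma card_fiber_comp_succAbove [DecidableEq ι] (b : Fin (n + 1) → ι) (p : Fin (n + 1)) (v : ι) :
    (Finset.univ.filter (b · = v)).card
      = (if b p = v then 1 else 0) + (Finset.univ.filter ((b ∘ p.succAbove) · = v)).card := by
  simp only [Finset.card_filter]
  exact Fin.sum_univ_succAbove _ p

/-- The number of fibrewise increasing permutations without fixed points in prescribed fibres
depends only on the fibre sizes. -/
theorem ncard_fiberPerms_eq [DecidableEq ι] (T : Finset ι) : ∀ {n : ℕ} (b c : Fin n → ι),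
    IntervalFibers b → IntervalFibers c →
    (∀ v, (Finset.univ.filter (b · = v)).card = (Finset.univ.filter (c · = v)).card) →
    (fiberPerms b T).ncard = (fiberPerms c T).ncard := by
  induction T using Finset.induction_on with
  | empty =>
    intro n b c _ _ h
    simpa using ncard_fiberPerms_empty b c h
  | insert i T hi ih =>
    intro n b c hb hc h
    rw [Finset.coe_insert, fiberPerms_insert, fiberPerms_insert]
    have hT := ih b c hb hc h
    have hb' := Set.ncard_inter_add_ncard_sdiff_eq_ncard (fiberPerms b T)
      {π | ∃ x, b x = i ∧ π x = x} (Set.toFinite _)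
    have hc' := Set.ncard_inter_add_ncard_sdiff_eq_ncard (fiberPerms c T)
      {π | ∃ x, c x = i ∧ π x = x} (Set.toFinite _)
    suffices (fiberPerms b T ∩ {π | ∃ x, b x = i ∧ π x = x}).ncard
        = (fiberPerms c T ∩ {π | ∃ x, c x = i ∧ π x = x}).ncard by omega
    by_cases hex : ∃ p, b p = i
    · obtain ⟨p, rfl⟩ := hex
      have hpos : 0 < (Finset.univ.filter (c · = b p)).card := by
        rw [← h]
        exact Finset.card_pos.2 ⟨p, by simp⟩
      obtain ⟨q, hq⟩ := Finset.card_pos.1 hpos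
      simp only [Finset.mem_filter, Finset.mem_univ, true_and] at hq
      cases n with
      | zero => exact p.elim0
      | succ n =>
        rw [ncard_fiberPerms_fixed hb p (by simpa using hi)]
        rw [← hq, ncard_fiberPerms_fixed hc q (by simpa [hq] using hi)]
        refine ih _ _ (hb.comp_succAbove p) (hc.comp_succAbove q) fun v => ?_
        have := h v
        rw [card_fiber_comp_succAbove b p, card_fiber_comp_succAbove c q, hq] at this
        omega
    · have hex' : ¬ ∃ q, c q = i := by
        rintro ⟨q, hq⟩
        have hpos : 0 < (Finset.univ.filter (b · = i)).card := by
          rw [h]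
          exact Finset.card_pos.2 ⟨q, by simp [hq]⟩
        obtain ⟨p, hp⟩ := Finset.card_pos.1 hpos
        exact hex ⟨p, by simpa using hp⟩
      have e1 : {π : Equiv.Perm (Fin n) | ∃ x, b x = i ∧ π x = x} = ∅ := by
        ext π; simp only [Set.mem_ofPred_eq, Set.mem_empty_iff_false, iff_false]; grind
      have e2 : {π : Equiv.Perm (Fin n) | ∃ x, c x = i ∧ π x = x} = ∅ := by
        ext π; simp only [Set.mem_ofPred_eq, Set.mem_empty_iff_false, iff_false]; grind
      rw [e1, e2]
      simp

/-- The number of cuts in `I` before position `x`. -/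
def cutsBefore (I : Finset ℕ) (x : ℕ) : ℕ := (I.filter (· < x)).card

lemma cutsBefore_mono (I : Finset ℕ) : Monotone (cutsBefore I) := fun _ _ h =>
  Finset.card_le_card (Finset.monotone_filter_right _ fun _ _ ha => lt_of_lt_of_le ha h)

lemma cutsBefore_eq_iff (I : Finset ℕ) {x y : ℕ} (h : x ≤ y) :
    cutsBefore I x = cutsBefore I y ↔ ∀ i ∈ I, ¬ (x ≤ i ∧ i < y) := by
  have hsub : I.filter (· < x) ⊆ I.filter (· < y) :=
    Finset.monotone_filter_right _ fun _ _ ha => lt_of_lt_of_le ha h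
  constructor
  · rintro he i hi ⟨h1, h2⟩
    have := Finset.eq_of_subset_of_card_le hsub he.symm.le
    have hmem : i ∈ I.filter (· < y) := by simp [hi, h2]
    rw [← this] at hmem
    simp at hmem
    omega
  · intro hno
    refine congrArg Finset.card (Finset.filter_congr fun i hi => ?_)
    have := hno i hi
    omega

lemma zipWith_sub_eq_map_card (n : ℕ) : ∀ (L : List ℕ) (a : ℕ), L.Pairwise (· < ·) → a ≤ n →
    (∀ c ∈ L, a ≤ c ∧ c ≤ n) →
    List.zipWith (· - ·) (L ++ [n]) (a :: L) = (List.range (L.length + 1)).map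
      fun j => ((Finset.Ico a n).filter fun x => L.countP (· ≤ x) = j).card := by
  intro L
  induction L with
  | nil => intro a _ _ _; simp
  | cons c L ih =>
    intro a hL ha hmem
    rw [List.pairwise_cons] at hL
    have hc := hmem c (by simp)
    rw [List.cons_append, List.zipWith_cons_cons, ih c hL.2 hc.2 fun d hd =>
      ⟨(hL.1 d hd).le, (hmem d (by simp [hd])).2⟩, List.length_cons,
      List.range_succ_eq_map (n := L.length + 1), List.map_cons, List.map_map]
    have hzero : ∀ x, x < c → L.countP (· ≤ x) = 0 := fun x hx => List.countP_eq_zero.2 fun d hd => by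
      have := hL.1 d hd
      simp; omega
    congr 1
    · rw [← Nat.card_Ico]
      congr 1
      ext x
      simp only [Finset.mem_Ico, Finset.mem_filter, List.countP_cons]
      by_cases hx : x < c
      · simp [hzero x hx, hx]; omega
      · simp [hx]
    · refine List.map_congr_left fun j _ => ?_
      congr 1
      ext x
      simp only [Finset.mem_Ico, Finset.mem_filter, List.countP_cons]
      by_cases hx : x < c
      · simp [hzero x hx, not_le.2 hx]
      · simp [not_lt.1 hx]
        omega

lemma compParts_eq {I : Finset ℕ} (hI : I ⊆ Finset.range (n - 1)) :
    compParts n I = (Multiset.range (I.card + 1)).map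
      fun j => ((Finset.range n).filter fun x => cutsBefore I x = j).card := by
  have hcount : ∀ x, ((I.sort (· ≤ ·)).map (· + 1)).countP (· ≤ x) = cutsBefore I x := by
    intro x
    rw [List.countP_map, cutsBefore, Finset.card_def, Finset.filter_val,
      ← Multiset.countP_eq_card_filter, ← I.sort_eq (· ≤ ·), Multiset.coe_countP]
    simp [Function.comp_def]
  rw [compParts, zipWith_sub_eq_map_card n _ 0 ?_ (Nat.zero_le _) ?_]
  · simp only [hcount, List.length_map, Finset.length_sort, Finset.range_eq_Ico]
    rfl
  · refine List.Pairwise.map _ (fun a b h => ?_) (I.sortedLT_sort).pairwise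
    simpa using h
  · intro c hc
    simp only [List.mem_map, Finset.mem_sort] at hc
    obtain ⟨i, hi, rfl⟩ := hc
    have := Finset.mem_range.1 (hI hi)
    omega

/-- The block containing each position, as an element of `Fin m`. -/
def blockLabel (n : ℕ) {m : ℕ} (I : Finset ℕ) (h : I.card < m) (x : Fin n) : Fin m :=
  ⟨cutsBefore I x, (Finset.card_filter_le _ _).trans_lt h⟩

lemma intervalFibers_blockLabel {m : ℕ} (I : Finset ℕ) (h : I.card < m) :
    IntervalFibers (blockLabel n I h) := fun x y z hxy hyz he => by
  have h1 := cutsBefore_mono I (Fin.le_def.1 hxy)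
  have h2 := cutsBefore_mono I (Fin.le_def.1 hyz)
  have h3 : cutsBefore I x = cutsBefore I z := congrArg Fin.val he
  exact Fin.ext (show cutsBefore I y = cutsBefore I x by omega)

lemma descSet_subset_iff {m : ℕ} (I : Finset ℕ) (h : I.card < m) (π : Equiv.Perm (Fin n)) :
    descSet π ⊆ I ↔ ∀ x y, x < y → blockLabel n I h x = blockLabel n I h y → π x < π y := by
  have hlab : ∀ x y : Fin n, x < y → (blockLabel n I h x = blockLabel n I h y ↔
      ∀ i ∈ I, ¬ ((x : ℕ) ≤ i ∧ i < y)) := fun x y hxy => by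
    rw [← cutsBefore_eq_iff I (Fin.le_def.1 hxy.le)]
    exact Fin.ext_iff
  have hdesc : ∀ i, i ∈ descSet π ↔
      ∃ h : i + 1 < n, π ⟨i + 1, h⟩ < π ⟨i, Nat.lt_of_succ_lt h⟩ := fun i => by
    simp only [descSet, descSeq, Finset.mem_filter, Finset.mem_range, Fin.lt_def]
    exact and_iff_right_of_imp fun ⟨h, _⟩ => by omega
  constructor
  · intro hsub
    have key : ∀ d x (hx : x + d + 1 < n), (∀ i ∈ I, ¬ (x ≤ i ∧ i < x + d + 1)) →
        π ⟨x, by omega⟩ < π ⟨x + d + 1, hx⟩ := by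
      intro d
      have step : ∀ x (hx : x + 1 < n), x ∉ I → π ⟨x, by omega⟩ < π ⟨x + 1, hx⟩ := by
        intro x hx hxI
        refine lt_of_le_of_ne (le_of_not_gt fun hlt => hxI (hsub ((hdesc x).2 ⟨hx, hlt⟩)))
          fun he => ?_
        have := congrArg Fin.val (π.injective he)
        simp at this
      induction d with
      | zero => exact fun x hx hno => step x hx fun hxI => hno x hxI (by omega)
      | succ d ih =>
        intro x hx hno
        exact (ih x (by omega) fun i hi hlt => hno i hi (by omega)).trans
          (step (x + d + 1) hx fun hxI => hno _ hxI (by omega))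
    intro x y hxy he
    have hno := (hlab x y hxy).1 he
    rw [Fin.lt_def] at hxy
    obtain ⟨d, hd⟩ : ∃ d, (y : ℕ) = x + d + 1 := ⟨y - x - 1, by omega⟩
    have := key d x (hd ▸ y.2) (by rwa [← hd])
    simpa only [← hd] using this
  · intro hmono i hi
    obtain ⟨hn, hlt⟩ := (hdesc i).1 hi
    by_contra hiI
    refine absurd (hmono ⟨i, by omega⟩ ⟨i + 1, hn⟩ (Fin.lt_def.2 (by simp)) ?_) hlt.asymm
    refine (hlab _ _ (Fin.lt_def.2 (by simp))).2 fun j hj hij => hiI ?_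
    have : j = i := by simp at hij; omega
    rwa [← this]

lemma card_derangements_eq {m : ℕ} (I : Finset ℕ) (h : I.card < m) :
    Nat.card {π : Equiv.Perm (Fin n) // (∀ x, π x ≠ x) ∧ descSet π ⊆ I}
      = (fiberPerms (blockLabel n I h) Set.univ).ncard := by
  rw [← Nat.card_coe_set_eq]
  refine Nat.card_congr (Equiv.subtypeEquivRight fun π => ?_)
  rw [descSet_subset_iff I h, and_comm]
  simp [fiberPerms]

lemma map_card_blockLabel {I : Finset ℕ} (hI : I ⊆ Finset.range (n - 1)) {m : ℕ}
    (h : I.card + 1 = m) :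
    (Finset.univ : Finset (Fin m)).val.map (fun j =>
      (Finset.univ.filter (blockLabel n I (Nat.lt_of_succ_le h.le) · = j)).card)
      = compParts n I := by
  subst h
  have hcard : ∀ j : Fin (I.card + 1),
      (Finset.univ.filter (blockLabel n I (Nat.lt_succ_self _) · = j)).card
        = ((Finset.range n).filter fun x => cutsBefore I x = j).card := fun j => by
    simp only [Finset.card_filter, Finset.sum_range, blockLabel, Fin.ext_iff]
  rw [compParts_eq hI]
  simp only [hcard, Fin.univ_val_map]
  rw [List.ofFn_eq_map, ← Multiset.coe_range, Multiset.map_coe, ← List.map_coe_finRange_eq_range,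
    List.map_map]
  rfl

end DerangementDescents

open DerangementDescents

theorem stmt11 (n : ℕ) (I J : Finset ℕ)
    (hI : I ⊆ Finset.range (n - 1)) (hJ : J ⊆ Finset.range (n - 1))
    (h : compParts n I = compParts n J) :
    Nat.card {π : Equiv.Perm (Fin n) // (∀ x, π x ≠ x) ∧ descSet π ⊆ I}
      = Nat.card {π : Equiv.Perm (Fin n) // (∀ x, π x ≠ x) ∧ descSet π ⊆ J} := by
  have hcard : J.card + 1 = I.card + 1 := by
    have := congrArg Multiset.card h
    simpa [compParts_eq hI, compParts_eq hJ] using this.symm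
  have hI' : I.card < I.card + 1 := Nat.lt_succ_self _
  have hJ' : J.card < I.card + 1 := by omega
  rw [card_derangements_eq I hI', card_derangements_eq J hJ']
  have hmap := ((map_card_blockLabel hI rfl).trans h).trans (map_card_blockLabel hJ hcard).symm
  obtain ⟨e, he, -⟩ := exists_perm_strictMono_on_fibers
    (fun j => (Finset.univ.filter (blockLabel n I hI' · = j)).card)
    (fun j => (Finset.univ.filter (blockLabel n J hJ' · = j)).card) fun v => by
      have := congrArg (Multiset.count v) hmap
      rw [Multiset.count_map, Multiset.count_map] at this
      simp only [@eq_comm ℕ v] at this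
      exact this
  have hcomp : fiberPerms (e ∘ blockLabel n I hI') Set.univ
      = fiberPerms (blockLabel n I hI') Set.univ := by
    simp [fiberPerms]
  rw [← hcomp, ← Finset.coe_univ]
  refine ncard_fiberPerms_eq _ _ _ (fun x y z hxy hyz hxz => congrArg e
    (intervalFibers_blockLabel I hI' x y z hxy hyz (e.injective hxz)))
    (intervalFibers_blockLabel J hJ') fun v => ?_
  obtain ⟨j, rfl⟩ := e.surjective v
  simpa using (he j).symm
end
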